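/- arXiv:1803.01239 — 3 statements merged into one kernel-verified Lean document; each statement's English description precedes it below -/
import Mathlib

section
/- Let G be a connected block graph on [n] such that every vertex of G either is a free vertex or has clique degree equal to 2 (that is, G is a complete graph or is obtained by gluing complete graphs at free vertices so that it is decomposable into blocks). Then the Krull dimension of S/J_G equals n + 1. -/
/-!
Common definitions: binomial edge ideals, cutsets, the prime ideals `P_T(G)`,
block graphs, clique degrees, endblocks, decomposability, and their relative
versions for induced subgraphs (an induced subgraph of `G` is recorded by its
vertex set `W`).
-/

noncomputable section
open MvPolynomial

/-- The edge binomial `f_{ij} = x_i y_j - x_j y_i` in `K[x_v, y_v : v ∈ V]`,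
encoded as `MvPolynomial (V ⊕ V) K` with `Sum.inl i ↦ x_i`, `Sum.inr i ↦ y_i`. -/
def ebin (K : Type*) [Field K] {V : Type*} (i j : V) : MvPolynomial (V ⊕ V) K :=
  X (Sum.inl i) * X (Sum.inr j) - X (Sum.inl j) * X (Sum.inr i)

/-- The binomial edge ideal `J_G`, generated by the `f_{ij}` over the edges of `G`. -/
def binomialEdgeIdeal (K : Type*) [Field K] {V : Type*} (G : SimpleGraph V) :
    Ideal (MvPolynomial (V ⊕ V) K) :=
  Ideal.span {p | ∃ i j, G.Adj i j ∧ p = ebin K i j}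

/-- The binomial edge ideal of the induced subgraph of `G` on `W`, regarded as an
ideal of the full polynomial ring on all of `V`. -/
def binomialEdgeIdealOn (K : Type*) [Field K] {V : Type*} (G : SimpleGraph V)
    (W : Set V) : Ideal (MvPolynomial (V ⊕ V) K) :=
  Ideal.span {p | ∃ i ∈ W, ∃ j ∈ W, G.Adj i j ∧ p = ebin K i j}

/-- `c(T)`: the number of connected components of the induced subgraph on `Tᶜ`. -/
def numComp {V : Type*} (G : SimpleGraph V) (T : Set V) : ℕ :=
  Nat.card (G.induce Tᶜ).ConnectedComponent

/-- `T` is a cutset of `G` if `c(T ∖ {i}) < c(T)` for every `i ∈ T`. -/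
def IsCutset {V : Type*} (G : SimpleGraph V) (T : Set V) : Prop :=
  ∀ i ∈ T, numComp G (T \ {i}) < numComp G T

/-- The prime ideal `P_T(G)`, generated by the variables `x_i, y_i` for `i ∈ T`
together with all binomials `f_{ij}` with `i ≠ j` in one connected component of
the induced subgraph on `Tᶜ`. -/
def cutIdeal (K : Type*) [Field K] {V : Type*} (G : SimpleGraph V) (T : Set V) :
    Ideal (MvPolynomial (V ⊕ V) K) :=
  Ideal.span ({p | ∃ i ∈ T, p = X (Sum.inl i) ∨ p = X (Sum.inr i)} ∪
    {p | ∃ i j, ∃ (hi : i ∈ Tᶜ) (hj : j ∈ Tᶜ), i ≠ j ∧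
      (G.induce Tᶜ).Reachable ⟨i, hi⟩ ⟨j, hj⟩ ∧ p = ebin K i j})

/-- A graph is a block graph iff all its blocks are complete; equivalently,
the vertices of every cycle form a clique. -/
def IsBlockGraph {V : Type*} (G : SimpleGraph V) : Prop :=
  ∀ (v : V) (c : G.Walk v v), c.IsCycle →
    ∀ x ∈ c.support, ∀ y ∈ c.support, x ≠ y → G.Adj x y

/-- The clique degree of `v`: the number of maximal cliques of `G` containing `v`. -/
def cliqueDeg {V : Type*} (G : SimpleGraph V) (v : V) : ℕ :=
  {s : Set V | Maximal G.IsClique s ∧ v ∈ s}.ncard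

/-- `v` is a cutpoint of `G`: removing it increases the number of connected components. -/
def IsCutpoint {V : Type*} (G : SimpleGraph V) (v : V) : Prop :=
  Nat.card G.ConnectedComponent < Nat.card (G.induce {v}ᶜ).ConnectedComponent

/-- An endblock of a block graph: a maximal clique with at least two vertices
containing exactly one cutpoint. -/
def IsEndblock {V : Type*} (G : SimpleGraph V) (B : Set V) : Prop :=
  Maximal G.IsClique B ∧ 2 ≤ B.ncard ∧ ∃! w, w ∈ B ∧ IsCutpoint G w

/-- `P_T(G) ∈ Minh(G)`: `T` is a cutset whose prime `P_T(G)` has minimum height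
among all `P_{T'}(G)` with `T'` a cutset; since `height P_T(G) = n - c(T) + |T|`,
this says `c(T') + |T| ≤ c(T) + |T'|` for all cutsets `T'`. -/
def InMinh {V : Type*} (G : SimpleGraph V) (T : Set V) : Prop :=
  IsCutset G T ∧ ∀ T', IsCutset G T' →
    numComp G T' + T.ncard ≤ numComp G T + T'.ncard

/-! Relative versions: the graph under consideration is the induced subgraph of
`G` on the vertex set `W`. -/

/-- Number of connected components of the induced subgraph on `W` after removing `T`. -/
def numCompOn {V : Type*} (G : SimpleGraph V) (W T : Set V) : ℕ :=
  Nat.card (G.induce (W \ T)).ConnectedComponent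

/-- `T` is a cutset of the induced subgraph of `G` on `W`. -/
def IsCutsetOn {V : Type*} (G : SimpleGraph V) (W T : Set V) : Prop :=
  T ⊆ W ∧ ∀ i ∈ T, numCompOn G W (T \ {i}) < numCompOn G W T

/-- `P_T ∈ Minh` for the induced subgraph of `G` on `W`. -/
def InMinhOn {V : Type*} (G : SimpleGraph V) (W T : Set V) : Prop :=
  IsCutsetOn G W T ∧ ∀ T', IsCutsetOn G W T' →
    numCompOn G W T' + T.ncard ≤ numCompOn G W T + T'.ncard

/-- `B` is a maximal clique of the induced subgraph of `G` on `W`. -/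
def IsMaxCliqueOn {V : Type*} (G : SimpleGraph V) (W B : Set V) : Prop :=
  Maximal (fun s => s ⊆ W ∧ G.IsClique s) B

/-- Clique degree of `v` in the induced subgraph of `G` on `W`. -/
def cliqueDegOn {V : Type*} (G : SimpleGraph V) (W : Set V) (v : V) : ℕ :=
  {B : Set V | IsMaxCliqueOn G W B ∧ v ∈ B}.ncard

/-- `w` is a cutpoint of the induced subgraph of `G` on `W`. -/
def IsCutpointOn {V : Type*} (G : SimpleGraph V) (W : Set V) (w : V) : Prop :=
  w ∈ W ∧ Nat.card (G.induce W).ConnectedComponent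
    < Nat.card (G.induce (W \ {w})).ConnectedComponent

/-- `B` is an endblock of the induced subgraph of `G` on `W`. -/
def IsEndblockOn {V : Type*} (G : SimpleGraph V) (W B : Set V) : Prop :=
  IsMaxCliqueOn G W B ∧ 2 ≤ B.ncard ∧ ∃! w, w ∈ B ∧ IsCutpointOn G W w

/-- The induced subgraph of `G` on `W` is decomposable: it is the union of two
subgraphs, each containing an edge, whose vertex sets `W₁, W₂` intersect in a
single vertex that is a free vertex of both. -/
def DecomposableOn {V : Type*} (G : SimpleGraph V) (W : Set V) : Prop :=
  ∃ W₁ W₂ : Set V, ∃ v : V, W₁ ∪ W₂ = W ∧ W₁ ∩ W₂ = {v} ∧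
    (∃ a ∈ W₁, ∃ b ∈ W₁, G.Adj a b) ∧ (∃ a ∈ W₂, ∃ b ∈ W₂, G.Adj a b) ∧
    (∀ a b, a ∈ W → b ∈ W → G.Adj a b → (a ∈ W₁ ∧ b ∈ W₁) ∨ (a ∈ W₂ ∧ b ∈ W₂)) ∧
    cliqueDegOn G W₁ v = 1 ∧ cliqueDegOn G W₂ v = 1

/-- `𝒟` is the decomposition of the induced subgraph of `G` on `W` into
indecomposable components: the members cover `W` and all its edges, each member
is indecomposable (an isolated vertex or a graph with an edge), and two distinct
members meet in at most one vertex, which is free in both. -/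
def IsDecompositionOn {V : Type*} (G : SimpleGraph V) (W : Set V)
    (𝒟 : Finset (Set V)) : Prop :=
  (∀ U ∈ 𝒟, U ⊆ W) ∧ ⋃₀ ↑𝒟 = W ∧
  (∀ a b, a ∈ W → b ∈ W → G.Adj a b → ∃ U ∈ 𝒟, a ∈ U ∧ b ∈ U) ∧
  (∀ U ∈ 𝒟, (∃ a ∈ U, ∃ b ∈ U, G.Adj a b) ∨ (∃ w, U = {w} ∧ ∀ u ∈ W, ¬ G.Adj w u)) ∧
  (∀ U₁ ∈ 𝒟, ∀ U₂ ∈ 𝒟, U₁ ≠ U₂ →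
    U₁ ∩ U₂ = ∅ ∨ ∃ w, U₁ ∩ U₂ = {w} ∧ cliqueDegOn G U₁ w = 1 ∧ cliqueDegOn G U₂ w = 1) ∧
  (∀ U ∈ 𝒟, ¬ DecomposableOn G U)

/-- `i(G)`: the number of inner vertices (vertices of clique degree `> 1`) of the
induced subgraph of `G` on `W`. -/
def innerCountOn {V : Type*} (G : SimpleGraph V) (W : Set V) : ℕ :=
  {v | v ∈ W ∧ 1 < cliqueDegOn G W v}.ncard

/-- A finitely generated domain over a field embedded in an algebra generated by a finite set `Z`
has Krull dimension at most the cardinality of `Z`. -/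
lemma ringKrullDim_le_card_of_range_le_adjoin {K : Type*} [Field K] {D L : Type*}
    [CommRing D] [IsDomain D] [Algebra K D] [Algebra.FiniteType K D] [Field L] [Algebra K L]
    (f : D →ₐ[K] L) (hf : Function.Injective f) (Z : Finset L)
    (hZ : f.range ≤ Algebra.adjoin K (Z : Set L)) :
    ringKrullDim D ≤ Z.card := by
  obtain ⟨s, g, hg, hint⟩ := exists_integral_inj_algHom_of_fg K D
  have hdim : ringKrullDim D ≤ s := by
    let := g.toRingHom.toAlgebra
    have : Algebra.IsIntegral (MvPolynomial (Fin s) K) D := ⟨hint⟩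
    have h : ringKrullDim D ≤ ringKrullDim (MvPolynomial (Fin s) K) :=
      Order.krullDim_le_of_strictMono
        (PrimeSpectrum.comap (algebraMap (MvPolynomial (Fin s) K) D))
        fun P Q hPQ => Ideal.IsIntegral.comap_lt_comap (I := P.asIdeal) (J := Q.asIdeal) hPQ
    simpa using h
  have hle : (Algebra.adjoin K (Z : Set L)) =
      (aeval (fun z : Z => (z : L)) : MvPolynomial Z K →ₐ[K] L).range := by
    rw [← Algebra.adjoin_range_eq_range_aeval]
    simp
  rw [hle] at hZ
  let φ : MvPolynomial (Fin s) K →ₐ[K]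
      (aeval (fun z : Z => (z : L)) : MvPolynomial Z K →ₐ[K] L).range :=
    (f.comp g).codRestrict _ fun p => hZ ⟨g p, rfl⟩
  have hφ : Function.Injective φ := fun a b hab => hg (hf (congrArg Subtype.val hab))
  have h₁ := lift_trdeg_le_of_injective φ hφ
  have h₂ := lift_trdeg_le_of_surjective
    (aeval (fun z : Z => (z : L)) : MvPolynomial Z K →ₐ[K] L).rangeRestrict
    (AlgHom.rangeRestrict_surjective _)
  simp only [MvPolynomial.trdeg_of_isDomain, Cardinal.mk_fintype, Fintype.card_fin,
    Cardinal.lift_natCast, Fintype.card_coe] at h₁ h₂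
  have h₃ : s ≤ Z.card := by
    rw [Cardinal.lift_le_nat_iff] at h₂
    exact_mod_cast h₁.trans (Cardinal.lift_le_nat_iff.2 h₂)
  exact hdim.trans (by exact_mod_cast h₃)

/-- The Krull dimension is bounded by the dimensions of the quotients by primes. -/
lemma ringKrullDim_le_of_forall_quotient_prime {R : Type*} [CommRing R] (m : WithBot ℕ∞)
    (h : ∀ P : Ideal R, P.IsPrime → ringKrullDim (R ⧸ P) ≤ m) : ringKrullDim R ≤ m := by
  rw [ringKrullDim, Order.krullDim_eq_iSup_coheight, iSup_le_iff]
  intro P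
  rw [Order.coheight_eq_krullDim_Ici]
  refine le_trans (le_of_eq ?_) (h P.asIdeal P.isPrime)
  rw [ringKrullDim_quotient]
  rfl

/-- The neighbours of a vertex of clique degree at most two are covered by two cliques. -/
lemma exists_two_cliques_of_cliqueDeg_le_two {V : Type*} [Finite V] (G : SimpleGraph V) (v : V)
    (hv : cliqueDeg G v ≤ 2) :
    ∃ C₁ C₂ : Set V, G.IsClique C₁ ∧ G.IsClique C₂ ∧ ∀ a, G.Adj v a → a ∈ C₁ ∨ a ∈ C₂ := by
  have hcov : ∀ a, G.Adj v a → ∃ C ∈ {s : Set V | Maximal G.IsClique s ∧ v ∈ s}, a ∈ C := by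
    intro a ha
    obtain ⟨C, hC, hmax⟩ := (Set.toFinite {s : Set V | G.IsClique s}).exists_le_maximal
      (a := {v, a}) (by simpa [SimpleGraph.isClique_pair] using fun _ => ha)
    exact ⟨C, ⟨hmax, hC (by simp)⟩, hC (by simp)⟩
  rw [cliqueDeg] at hv
  obtain h | h | h : _ = 0 ∨ _ = 1 ∨ _ = 2 := by
    exact (by omega : ∀ k : ℕ, k ≤ 2 → k = 0 ∨ k = 1 ∨ k = 2) _ hv
  · rw [Set.ncard_eq_zero] at h
    simp only [h] at hcov
    exact ⟨∅, ∅, by simp, by simp, fun a ha => by simpa using hcov a ha⟩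
  · obtain ⟨C, hC⟩ := Set.ncard_eq_one.1 h
    have hmem : C ∈ {s : Set V | Maximal G.IsClique s ∧ v ∈ s} := by simp [hC]
    rw [hC] at hcov
    exact ⟨C, C, hmem.1.prop, hmem.1.prop, fun a ha => by simpa using hcov a ha⟩
  · obtain ⟨C₁, C₂, -, hC⟩ := Set.ncard_eq_two.1 h
    have hmem₁ : C₁ ∈ {s : Set V | Maximal G.IsClique s ∧ v ∈ s} := by simp [hC]
    have hmem₂ : C₂ ∈ {s : Set V | Maximal G.IsClique s ∧ v ∈ s} := by simp [hC]
    rw [hC] at hcov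
    exact ⟨C₁, C₂, hmem₁.1.prop, hmem₂.1.prop, fun a ha => by simpa using hcov a ha⟩

/-- A function which is constant along the edges inside a clique minus `T` is constant there. -/
lemma exists_forall_eq_of_isClique {V α : Type*} [Nonempty α] {G : SimpleGraph V} {T C : Set V}
    (ρ : V → α) (hρ : ∀ i j, i ∉ T → j ∉ T → G.Adj i j → ρ i = ρ j) (hC : G.IsClique C) :
    ∃ c, ∀ a ∈ C, a ∉ T → ρ a = c := by
  by_cases h : ∃ b ∈ C, b ∉ T
  · obtain ⟨b, hb, hbT⟩ := h
    refine ⟨ρ b, fun a ha haT => ?_⟩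
    by_cases hab : a = b
    · rw [hab]
    · exact hρ a b haT hbT (hC ha hb hab)
  · push Not at h
    exact ⟨Classical.arbitrary α, fun a ha haT => absurd (h a ha) haT⟩

/-- If all clique degrees are at most two, deleting `T` from a connected graph leaves at most
`|T| + 1` components: a function constant along the remaining edges takes at most `|T| + 1`
values on the remaining vertices. -/
lemma card_image_compl_le {V α : Type*} [Fintype V] [DecidableEq V] [DecidableEq α]
    (G : SimpleGraph V) (hconn : G.Connected) (hdeg : ∀ v, cliqueDeg G v ≤ 2) (T : Finset V)
    (ρ : V → α) (hρ : ∀ i j, i ∉ T → j ∉ T → G.Adj i j → ρ i = ρ j) :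
    (Tᶜ.image ρ).card ≤ T.card + 1 := by
  induction T using Finset.induction_on generalizing ρ with
  | empty =>
    obtain ⟨v⟩ := hconn.nonempty
    have hconst : ∀ w, ρ v = ρ w := fun w => by
      obtain ⟨p⟩ := hconn.preconnected v w
      induction p with
      | nil => rfl
      | cons h _ ih => exact (hρ _ _ (by simp) (by simp) h).trans ih
    refine (Finset.card_le_card (t := {ρ v}) ?_).trans (by simp)
    intro a ha
    obtain ⟨w, -, rfl⟩ := Finset.mem_image.1 ha
    simp [hconst w]
  | insert v T hv ih =>
    have : Nonempty α := ⟨ρ v⟩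
    obtain ⟨C₁, C₂, hC₁, hC₂, hcov⟩ := exists_two_cliques_of_cliqueDeg_le_two G v (hdeg v)
    have hρ' : ∀ i j, i ∉ (↑(insert v T) : Set V) → j ∉ (↑(insert v T) : Set V) →
      G.Adj i j → ρ i = ρ j := fun i j hi hj => hρ i j (by simpa using hi) (by simpa using hj)
    obtain ⟨c₁, hc₁⟩ := exists_forall_eq_of_isClique ρ hρ' hC₁
    obtain ⟨c₂, hc₂⟩ := exists_forall_eq_of_isClique ρ hρ' hC₂
    let σ : V → α := fun w => if w = v ∨ ρ w = c₂ then c₁ else ρ w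
    have hσv : σ v = c₁ := by simp [σ]
    have hσ : ∀ a, a ∉ T → G.Adj v a → σ a = c₁ := by
      intro a haT ha
      have ha' : a ∉ (↑(insert v T) : Set V) := by simp [ha.ne', haT]
      rcases hcov a ha with h | h
      · simp [σ, hc₁ a h ha']
      · simp [σ, hc₂ a h ha']
    have hcard := ih σ fun i j hi hj hij => by
      by_cases hiv : i = v
      · subst hiv
        rw [hσv, hσ j hj hij]
      by_cases hjv : j = v
      · subst hjv
        rw [hσv, hσ i hi hij.symm]
      have := hρ i j (by simp [hiv, hi]) (by simp [hjv, hj]) hij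
      simp [σ, hiv, hjv, this]
    have hsub : (insert v T)ᶜ.image ρ ⊆ insert c₂ (Tᶜ.image σ) := by
      intro a ha
      obtain ⟨w, hw, rfl⟩ := Finset.mem_image.1 ha
      simp only [Finset.mem_compl, Finset.mem_insert, not_or] at hw
      by_cases h : ρ w = c₂
      · simp [h]
      · refine Finset.mem_insert_of_mem (Finset.mem_image.2 ⟨w, by simpa using hw.2, ?_⟩)
        simp [σ, hw.1, h]
    have := (Finset.card_le_card hsub).trans (Finset.card_insert_le _ _)
    rw [Finset.card_insert_of_notMem hv]
    omega

/-- If adjacent pairs `(x i, y i)` are proportional and all clique degrees are at most two, then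
all coordinates lie in an algebra with `|V| + 1` generators. -/
lemma exists_finset_coordinates_mem_adjoin (K : Type*) {L V : Type*} [Field K] [Field L]
    [Algebra K L] [Fintype V] (G : SimpleGraph V) (hconn : G.Connected)
    (hdeg : ∀ v, cliqueDeg G v ≤ 2) (x y : V → L)
    (hxy : ∀ i j, G.Adj i j → x i * y j = x j * y i) :
    ∃ Z : Finset L, Z.card ≤ Fintype.card V + 1 ∧
      ∀ i, x i ∈ Algebra.adjoin K (Z : Set L) ∧ y i ∈ Algebra.adjoin K (Z : Set L) := by
  classical
  let T : Finset V := {i | x i = 0 ∧ y i = 0}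
  let z : V → L := fun i => if x i = 0 then y i else x i
  let ρ : V → L := fun i => y i / x i
  have hρ : (Tᶜ.image ρ).card ≤ T.card + 1 := by
    refine card_image_compl_le G hconn hdeg T ρ fun i j hi hj hij => ?_
    have h := hxy i j hij
    simp only [T, Finset.mem_filter, Finset.mem_univ, true_and, not_and] at hi hj
    by_cases hxi : x i = 0
    · have : x j = 0 := by simpa [hxi, hi hxi] using h
      simp [ρ, hxi, this]
    · have hxj : x j ≠ 0 := fun hxj => by simp [hxj, hxi, hj hxj] at h
      simp only [ρ]
      field_simp
      linear_combination -h
  refine ⟨Tᶜ.image z ∪ Tᶜ.image ρ, ?_, fun i => ?_⟩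
  · have h₁ := Finset.card_union_le (Tᶜ.image z) (Tᶜ.image ρ)
    have h₂ := Finset.card_image_le (s := Tᶜ) (f := z)
    have h₃ := Finset.card_add_card_compl T
    omega
  · by_cases hi : i ∈ T
    · obtain ⟨hx, hy⟩ : x i = 0 ∧ y i = 0 := by simpa [T] using hi
      rw [hx, hy]
      exact ⟨zero_mem _, zero_mem _⟩
    have hz : z i ∈ Algebra.adjoin K (↑(Tᶜ.image z ∪ Tᶜ.image ρ) : Set L) :=
      Algebra.subset_adjoin (Finset.mem_coe.2 (Finset.mem_union_left _
        (Finset.mem_image_of_mem _ (Finset.mem_compl.2 hi))))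
    have hr : ρ i ∈ Algebra.adjoin K (↑(Tᶜ.image z ∪ Tᶜ.image ρ) : Set L) :=
      Algebra.subset_adjoin (Finset.mem_coe.2 (Finset.mem_union_right _
        (Finset.mem_image_of_mem _ (Finset.mem_compl.2 hi))))
    by_cases hx : x i = 0
    · rw [show z i = y i by simp [z, hx]] at hz
      exact ⟨hx ▸ zero_mem _, hz⟩
    · rw [show z i = x i by simp [z, hx]] at hz
      refine ⟨hz, ?_⟩
      have : y i = x i * ρ i := by simp only [ρ]; field_simp
      rw [this]
      exact mul_mem hz hr

/-- If all clique degrees are at most two, then `dim S/J_G ≤ |V| + 1`. -/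
lemma ringKrullDim_quotient_binomialEdgeIdeal_le (K : Type*) [Field K] {V : Type*} [Fintype V]
    (G : SimpleGraph V) (hconn : G.Connected) (hdeg : ∀ v, cliqueDeg G v ≤ 2) :
    ringKrullDim (MvPolynomial (V ⊕ V) K ⧸ binomialEdgeIdeal K G)
      ≤ ((Fintype.card V + 1 : ℕ) : WithBot ℕ∞) := by
  refine ringKrullDim_le_of_forall_quotient_prime _ fun P hP => ?_
  let π : MvPolynomial (V ⊕ V) K →ₐ[K] (MvPolynomial (V ⊕ V) K ⧸ binomialEdgeIdeal K G) ⧸ P :=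
    (Ideal.Quotient.mkₐ K P).comp (Ideal.Quotient.mkₐ K (binomialEdgeIdeal K G))
  have hπ : Function.Surjective π :=
    (Ideal.Quotient.mkₐ_surjective K P).comp (Ideal.Quotient.mkₐ_surjective K _)
  have : Algebra.FiniteType K ((MvPolynomial (V ⊕ V) K ⧸ binomialEdgeIdeal K G) ⧸ P) :=
    Algebra.FiniteType.of_surjective π hπ
  let L := FractionRing ((MvPolynomial (V ⊕ V) K ⧸ binomialEdgeIdeal K G) ⧸ P)
  let f : ((MvPolynomial (V ⊕ V) K ⧸ binomialEdgeIdeal K G) ⧸ P) →ₐ[K] L :=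
    IsScalarTower.toAlgHom K _ L
  obtain ⟨Z, hZ, hmem⟩ := exists_finset_coordinates_mem_adjoin K G hconn hdeg
    (fun i => f (π (X (Sum.inl i)))) (fun i => f (π (X (Sum.inr i)))) (fun i j hij => by
      have h0 : π (ebin K i j) = 0 := by
        have : Ideal.Quotient.mk (binomialEdgeIdeal K G) (ebin K i j) = 0 :=
          Ideal.Quotient.eq_zero_iff_mem.2 (Ideal.subset_span ⟨i, j, hij, rfl⟩)
        simp [π, this]
      have := congrArg f h0
      simpa [ebin, sub_eq_zero] using this)
  refine (ringKrullDim_le_card_of_range_le_adjoin f (IsFractionRing.injective _ L) Z ?_).trans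
    (by exact_mod_cast hZ)
  have hrange : f.range = (f.comp π).range := by
    rw [AlgHom.range_comp, AlgHom.range_eq_top π |>.2 hπ, Algebra.map_top]
  rw [hrange, show f.comp π = aeval (fun i => f (π (X i))) from MvPolynomial.algHom_ext (by simp),
    ← Algebra.adjoin_range_eq_range_aeval, Algebra.adjoin_le_iff]
  rintro _ ⟨i | i, rfl⟩
  exacts [(hmem i).1, (hmem i).2]

/-- For every graph on a nonempty vertex set, `|V| + 1 ≤ dim S/J_G`. -/
lemma le_ringKrullDim_quotient_binomialEdgeIdeal (K : Type*) [Field K] {V : Type*} [Finite V]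
    [Nonempty V] (G : SimpleGraph V) :
    ((Nat.card V + 1 : ℕ) : WithBot ℕ∞)
      ≤ ringKrullDim (MvPolynomial (V ⊕ V) K ⧸ binomialEdgeIdeal K G) := by
  let φ : MvPolynomial (V ⊕ V) K →ₐ[K] MvPolynomial (Option V) K :=
    aeval (Sum.elim (fun i => X (some i)) (fun i => X (some i) * X none))
  let ψ : MvPolynomial (Option V) K →ₐ[K] MvPolynomial V K :=
    aeval (fun o => o.elim 0 X)
  have hker : ∀ p ∈ binomialEdgeIdeal K G, φ p = 0 := by
    intro p hp
    refine (Ideal.span_le (I := RingHom.ker φ)).2 ?_ hp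
    rintro _ ⟨i, j, -, rfl⟩
    simp only [SetLike.mem_coe, RingHom.mem_ker, ebin, φ, map_sub, map_mul, aeval_X, Sum.elim_inl,
      Sum.elim_inr]
    ring
  obtain ⟨v⟩ := ‹Nonempty V›
  have hψ : Function.Surjective (ψ.comp φ.range.val) := by
    have h : (ψ.comp φ).comp (rename Sum.inl) = AlgHom.id K (MvPolynomial V K) :=
      MvPolynomial.algHom_ext fun i => by simp [φ, ψ]
    exact fun p => ⟨⟨φ (rename Sum.inl p), _, rfl⟩, DFunLike.congr_fun h p⟩
  have h := ringKrullDim_succ_le_of_surjective (ψ.comp φ.range.val).toRingHom hψ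
    (r := (⟨φ (X (Sum.inr v)), _, rfl⟩ : φ.range))
    (mem_nonZeroDivisors_of_ne_zero fun h => by simpa [φ] using congrArg Subtype.val h)
    (show ψ (φ (X (Sum.inr v))) = 0 by simp [φ, ψ])
  have h' := ringKrullDim_le_of_surjective
    (Ideal.Quotient.lift (binomialEdgeIdeal K G) φ.rangeRestrict.toRingHom
      fun p hp => Subtype.ext (hker p hp))
    (Ideal.Quotient.lift_surjective_of_surjective _ _ φ.rangeRestrict_surjective)
  refine le_trans (le_of_eq ?_) (h.trans h')
  simp

/-- if `G` is a connected block graph in which every vertex is free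
or has clique degree `2`, then `dim S/J_G = n + 1`. -/
theorem ringKrullDim_of_free_or_two (n : ℕ) (K : Type*) [Field K]
    (G : SimpleGraph (Fin n)) (hconn : G.Connected) (hblock : IsBlockGraph G)
    (hdeg : ∀ v : Fin n, cliqueDeg G v = 1 ∨ cliqueDeg G v = 2) :
    ringKrullDim (MvPolynomial (Fin n ⊕ Fin n) K ⧸ binomialEdgeIdeal K G)
      = ((n + 1 : ℕ) : WithBot ℕ∞) := by
  have := hconn.nonempty
  refine le_antisymm ?_ ?_
  · simpa using ringKrullDim_quotient_binomialEdgeIdeal_le K G hconn fun v => by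
      have := hdeg v
      omega
  · simpa using le_ringKrullDim_quotient_binomialEdgeIdeal K G
end
end

section
/- Let G be a graph on [n] decomposable into G_1 and G_2, i.e. G = G_1 ∪ G_2 with V(G_1) ∩ V(G_2) = {v} where v is a free vertex of both G_1 and G_2 and each G_i contains at least one edge. Then dim S/J_G = dim S_1/J_{G_1} + dim S_2/J_{G_2} − 2, where S_i = K[x_j, y_j : j ∈ V(G_i)] and dim denotes Krull dimension. -/
/-!
Common definitions: binomial edge ideals, cutsets, the prime ideals `P_T(G)`,
block graphs, clique degrees, endblocks, decomposability, and their relative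
versions for induced subgraphs (an induced subgraph of `G` is recorded by its
vertex set `W`).
-/

noncomputable section
open MvPolynomial

/-- An injective integral extension of domains preserves the Krull dimension. -/
lemma ringKrullDim_eq_of_isIntegral_of_injective {R A : Type*} [CommRing R] [IsDomain R]
    [CommRing A] [IsDomain A] [Algebra R A] [Algebra.IsIntegral R A]
    (hinj : Function.Injective (algebraMap R A)) : ringKrullDim A = ringKrullDim R := by
  apply le_antisymm
  · refine Order.krullDim_le_of_strictMono (PrimeSpectrum.comap (algebraMap R A)) ?_
    intro P Q hPQ
    exact Ideal.IsIntegral.comap_lt_comap hPQ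
  · refine iSup_le fun l ↦ ?_
    have hs : Function.Surjective (PrimeSpectrum.comap (algebraMap R A)) :=
      RingHom.IsIntegral.comap_surjective (algebraMap_isIntegral_iff.mpr inferInstance) hinj
    obtain ⟨P, hP⟩ := hs l.head
    have : P.asIdeal.LiesOver (RelSeries.head l).asIdeal := ⟨by rw [← hP]; rfl⟩
    obtain ⟨L, hL, -⟩ := Ideal.exists_ltSeries_of_hasGoingUp l P.asIdeal
    rw [← hL]
    exact le_iSup_of_le L le_rfl

/-- The Krull dimension of an affine domain is its transcendence degree. -/
lemma ringKrullDim_eq_of_trdeg_eq {k A : Type*} [Field k] [CommRing A] [IsDomain A] [Algebra k A]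
    [Algebra.FiniteType k A] {d : ℕ} (hd : Algebra.trdeg k A = d) : ringKrullDim A = d := by
  obtain ⟨s, g, hg, hgint⟩ := exists_integral_inj_algHom_of_fg k A
  let _ : Algebra (MvPolynomial (Fin s) k) A := g.toRingHom.toAlgebra
  have : IsScalarTower k (MvPolynomial (Fin s) k) A :=
    IsScalarTower.of_algebraMap_eq fun x ↦ (g.commutes x).symm
  have : Algebra.IsIntegral (MvPolynomial (Fin s) k) A := ⟨hgint⟩
  have : FaithfulSMul (MvPolynomial (Fin s) k) A :=
    (faithfulSMul_iff_algebraMap_injective _ _).mpr hg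
  have h := lift_trdeg_add_eq k (MvPolynomial (Fin s) k) A
  rw [trdeg_eq_zero_iff (R := MvPolynomial (Fin s) k) (A := A) |>.mpr inferInstance, hd] at h
  have hs : s = d := by simpa using h
  rw [ringKrullDim_eq_of_isIntegral_of_injective (R := MvPolynomial (Fin s) k) hg,
    MvPolynomial.ringKrullDim_of_isNoetherianRing, ringKrullDim_eq_zero_of_field]
  simp [hs]

/-- A partial colouring of the vertices whose colour classes are unions of components
of the induced subgraph on the coloured vertices. -/
def IsPartialComponentColoring {V C : Type*} (G : SimpleGraph V) (f : V → Option C) : Prop :=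
  ∀ i j, G.Adj i j → ∀ c d, f i = some c → f j = some d → c = d

/-- The number of coloured vertices plus the number of colours in use. -/
def coloringDim {V C : Type*} (f : V → Option C) : ℕ :=
  {i | f i ≠ none}.ncard + {c | ∃ i, f i = some c}.ncard

lemma finite_colors {V C : Type*} [Finite V] (f : V → Option C) :
    {c | ∃ i, f i = some c}.Finite := by
  have h : (some '' {c | ∃ i, f i = some c}).Finite :=
    (Set.finite_range f).subset (by rintro _ ⟨c, ⟨i, hi⟩, rfl⟩; exact ⟨i, hi⟩)
  exact h.of_finite_image (Option.some_injective C).injOn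

lemma trdeg_mvPolynomial_coloring (K : Type*) [Field K] {V : Type} {C : Type*} [Finite V]
    (f : V → Option C) :
    Algebra.trdeg K (MvPolynomial ({i | f i ≠ none} ⊕ {c | ∃ i, f i = some c}) K)
      = coloringDim f := by
  have := (finite_colors f).to_subtype
  rw [MvPolynomial.trdeg_of_isDomain, Cardinal.mk_sum, ← Set.cast_ncard (Set.toFinite _),
    ← Set.cast_ncard (Set.toFinite _)]
  simp [coloringDim]

/-- The generic point of the variety of `J_G` with the given colour classes. -/
def coloringPoint (K : Type*) [Field K] {V C : Type*} (f : V → Option C) :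
    V ⊕ V → MvPolynomial ({i | f i ≠ none} ⊕ {c | ∃ i, f i = some c}) K := by
  classical
  exact Sum.elim
    (fun i ↦ if h : f i = none then 0 else X (Sum.inl ⟨i, h⟩))
    (fun i ↦ if h : f i = none then 0 else X (Sum.inl ⟨i, h⟩) *
      X (Sum.inr ⟨(f i).get (Option.isSome_iff_ne_none.mpr h), i, by simp⟩))

lemma coloringPoint_inl (K : Type*) [Field K] {V C : Type*} (f : V → Option C)
    {i : V} (h : f i ≠ none) : coloringPoint K f (Sum.inl i) = X (Sum.inl ⟨i, h⟩) := by
  simp only [coloringPoint, Sum.elim_inl]; rw [dif_neg h]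

lemma coloringPoint_inr (K : Type*) [Field K] {V C : Type*} (f : V → Option C)
    {i : V} {c : C} (h : f i = some c) : coloringPoint K f (Sum.inr i) =
      X (Sum.inl ⟨i, by simp [h]⟩) * X (Sum.inr ⟨c, i, h⟩) := by
  simp only [coloringPoint, Sum.elim_inr]; rw [dif_neg (by simp [h])]
  congr! 4
  simp [h]

lemma coloringPoint_of_none (K : Type*) [Field K] {V C : Type*} (f : V → Option C)
    {i : V} (h : f i = none) :
    coloringPoint K f (Sum.inl i) = 0 ∧ coloringPoint K f (Sum.inr i) = 0 := by
  simp only [coloringPoint, Sum.elim_inl, Sum.elim_inr]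
  rw [dif_pos h, dif_pos h]; simp

lemma binomialEdgeIdeal_le_ker_coloringPoint (K : Type*) [Field K] {V C : Type*}
    {G : SimpleGraph V} {f : V → Option C} (hf : IsPartialComponentColoring G f) :
    binomialEdgeIdeal K G ≤ RingHom.ker (aeval (R := K) (coloringPoint K f)) := by
  refine Ideal.span_le.mpr ?_
  rintro _ ⟨i, j, hij, rfl⟩
  simp only [SetLike.mem_coe, RingHom.mem_ker, ebin, map_sub, map_mul, aeval_X]
  rcases hi : f i with _ | c
  · simp [coloringPoint_of_none K f hi]
  rcases hj : f j with _ | d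
  · simp [coloringPoint_of_none K f hj]
  obtain rfl := hf i j hij c d hi hj
  rw [coloringPoint_inl K f (by simp [hi]), coloringPoint_inl K f (by simp [hj]),
    coloringPoint_inr K f hi, coloringPoint_inr K f hj]
  ring

lemma trdeg_range_coloringPoint (K : Type*) [Field K] {V : Type} {C : Type*} [Finite V]
    (f : V → Option C) :
    Algebra.trdeg K (aeval (R := K) (coloringPoint K f)).range = coloringDim f := by
  set A := (aeval (R := K) (coloringPoint K f)).range
  have hmem : ∀ s, coloringPoint K f s ∈ A := fun s ↦ ⟨X s, by simp⟩
  have hl : ∀ i, X (Sum.inl i) ∈ A := fun i ↦ by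
    have := hmem (Sum.inl i.1); rwa [coloringPoint_inl K f i.2] at this
  have halg : Algebra.IsAlgebraic A
      (MvPolynomial ({i | f i ≠ none} ⊕ {c | ∃ i, f i = some c}) K) := by
    have hle : Algebra.adjoin K (Set.range X) ≤
        (Subalgebra.algebraicClosure A (MvPolynomial
          ({i | f i ≠ none} ⊕ {c | ∃ i, f i = some c}) K)).restrictScalars K := by
      refine Algebra.adjoin_le ?_
      rintro _ ⟨i | ⟨c, i, hc⟩, rfl⟩
      · exact isAlgebraic_algebraMap (⟨_, hl i⟩ : A)
      · have hi : f i ≠ none := by simp [hc]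
        have hm := hmem (Sum.inr i)
        rw [coloringPoint_inr K f hc] at hm
        refine ⟨Polynomial.C ⟨_, hl ⟨i, hi⟩⟩ * Polynomial.X - Polynomial.C ⟨_, hm⟩, ?_, ?_⟩
        · intro h0
          have h1 := congrArg (Polynomial.coeff · 1) h0
          simp only [Polynomial.coeff_sub, Polynomial.coeff_C_mul, Polynomial.coeff_X_one,
            Polynomial.coeff_C_succ, Polynomial.coeff_zero, mul_one, sub_zero] at h1
          exact X_ne_zero _ (congrArg Subtype.val h1)
        · simp
    rw [adjoin_range_X] at hle
    exact ⟨fun x ↦ hle (Algebra.mem_top (x := x))⟩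
  have h := trdeg_add_eq K A
    (A := MvPolynomial ({i | f i ≠ none} ⊕ {c | ∃ i, f i = some c}) K)
  rwa [trdeg_eq_zero_iff.mpr halg, add_zero, trdeg_mvPolynomial_coloring] at h

lemma coloringDim_le_ringKrullDim (K : Type*) [Field K] {V : Type} {C : Type*} [Finite V]
    {G : SimpleGraph V} {f : V → Option C} (hf : IsPartialComponentColoring G f) :
    (coloringDim f : WithBot ℕ∞) ≤
      ringKrullDim (MvPolynomial (V ⊕ V) K ⧸ binomialEdgeIdeal K G) := by
  have hft : Algebra.FiniteType K (aeval (R := K) (coloringPoint K f)).range :=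
    Algebra.FiniteType.of_surjective (aeval (R := K) (coloringPoint K f)).rangeRestrict
      (AlgHom.rangeRestrict_surjective _)
  rw [← ringKrullDim_eq_of_trdeg_eq (trdeg_range_coloringPoint K f)]
  refine ringKrullDim_le_of_surjective
    (Ideal.Quotient.lift (binomialEdgeIdeal K G)
      (aeval (R := K) (coloringPoint K f)).rangeRestrict.toRingHom fun a ha ↦ ?_) ?_
  · exact Subtype.ext (binomialEdgeIdeal_le_ker_coloringPoint K hf ha)
  · exact Ideal.Quotient.lift_surjective_of_surjective _ _ (AlgHom.rangeRestrict_surjective _)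

lemma exists_coloring_trdeg_le (K : Type*) [Field K] {V : Type} [Finite V]
    (G : SimpleGraph V) (P : Ideal (MvPolynomial (V ⊕ V) K)) [P.IsPrime]
    (hP : binomialEdgeIdeal K G ≤ P) :
    ∃ f : V → Option (Option (FractionRing (MvPolynomial (V ⊕ V) K ⧸ P))),
      IsPartialComponentColoring G f ∧
        Algebra.trdeg K (MvPolynomial (V ⊕ V) K ⧸ P) ≤ coloringDim f := by
  classical
  set L := MvPolynomial (V ⊕ V) K ⧸ P
  set F := FractionRing L
  set q : MvPolynomial (V ⊕ V) K →ₐ[K] F :=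
    (IsScalarTower.toAlgHom K L F).comp (Ideal.Quotient.mkₐ K P)
  have hq : ∀ p ∈ P, q p = 0 := fun p hp ↦ by
    have : Ideal.Quotient.mkₐ K P p = 0 := Ideal.Quotient.eq_zero_iff_mem.mpr hp
    simp only [q, AlgHom.comp_apply, this, map_zero]
  set x : V → F := fun i ↦ q (X (Sum.inl i))
  set y : V → F := fun i ↦ q (X (Sum.inr i))
  have hedge : ∀ i j, G.Adj i j → x i * y j = x j * y i := fun i j hij ↦ by
    have := hq _ (hP (Ideal.subset_span ⟨i, j, hij, rfl⟩))
    simpa [ebin, sub_eq_zero, x, y] using this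
  let f : V → Option (Option F) := fun i ↦
    if x i = 0 then (if y i = 0 then none else some none) else some (some (y i / x i))
  refine ⟨f, ?_, ?_⟩
  · intro i j hij c d hc hd
    have h := hedge i j hij
    by_cases hi : x i = 0 <;> by_cases hj : x j = 0 <;> by_cases hi' : y i = 0 <;>
      by_cases hj' : y j = 0 <;> simp_all [f]
    all_goals
      subst hc hd
      congr 1
      rw [div_eq_div_iff hi hj]
      linear_combination -h
  · have hfx : ∀ i, x i ≠ 0 → f i = some (some (y i / x i)) := fun i hi ↦ by simp [f, hi]
    have hfy : ∀ i, x i = 0 → y i ≠ 0 → f i ≠ none := fun i hi hi' ↦ by simp [f, hi, hi']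
    let ψ : MvPolynomial ({i | f i ≠ none} ⊕ {c | ∃ i, f i = some c}) K →ₐ[K] F :=
      aeval (Sum.elim (fun i ↦ if x i = 0 then y i else x i) (fun c ↦ c.1.getD 0))
    have hx : ∀ i, x i ∈ ψ.range := fun i ↦ by
      by_cases hi : x i = 0
      · rw [hi]; exact zero_mem _
      · exact ⟨X (Sum.inl ⟨i, by simp [hfx i hi]⟩), by simp [ψ, hi]⟩
    have hy : ∀ i, y i ∈ ψ.range := fun i ↦ by
      by_cases hi : x i = 0
      · by_cases hi' : y i = 0
        · rw [hi']; exact zero_mem _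
        · exact ⟨X (Sum.inl ⟨i, hfy i hi hi'⟩), by simp [ψ, hi]⟩
      · have hm : y i / x i ∈ ψ.range :=
          ⟨X (Sum.inr ⟨some (y i / x i), i, hfx i hi⟩), by simp [ψ]⟩
        have := mul_mem (hx i) hm
        rwa [mul_div_cancel₀ _ hi] at this
    have hle : q.range ≤ ψ.range := by
      rw [← Algebra.map_top, ← adjoin_range_X, AlgHom.map_adjoin, Algebra.adjoin_le_iff]
      rintro _ ⟨_, ⟨i | i, rfl⟩, rfl⟩
      exacts [hx i, hy i]
    have hmem : ∀ a : L, IsScalarTower.toAlgHom K L F a ∈ ψ.range := fun a ↦ by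
      obtain ⟨p, rfl⟩ := Ideal.Quotient.mkₐ_surjective K P a
      exact hle ⟨p, rfl⟩
    refine (trdeg_le_of_injective ((IsScalarTower.toAlgHom K L F).codRestrict _ hmem)
      ?_).trans ?_
    · intro a b hab
      exact IsFractionRing.injective L F (congrArg Subtype.val hab)
    · rw [← trdeg_mvPolynomial_coloring K f]
      exact trdeg_le_of_surjective ψ.rangeRestrict (AlgHom.rangeRestrict_surjective _)

lemma exists_coloring_ringKrullDim_eq.{u} (K : Type u) [Field K] {V : Type} [Finite V]
    (G : SimpleGraph V) :
    ∃ (C : Type u) (f : V → Option C), IsPartialComponentColoring G f ∧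
      ringKrullDim (MvPolynomial (V ⊕ V) K ⧸ binomialEdgeIdeal K G) = coloringDim f := by
  set J := binomialEdgeIdeal K G
  have h0 := coloringDim_le_ringKrullDim K (G := G) (f := fun _ ↦ (none : Option Unit))
    (by simp [IsPartialComponentColoring])
  have htop : ringKrullDim (MvPolynomial (V ⊕ V) K ⧸ J) ≤ (Nat.card (V ⊕ V) : ℕ) := by
    refine (ringKrullDim_quotient_le J).trans ?_
    rw [MvPolynomial.ringKrullDim_of_isNoetherianRing, ringKrullDim_eq_zero_of_field, zero_add]
  obtain ⟨d, hd⟩ : ∃ d : ℕ, ringKrullDim (MvPolynomial (V ⊕ V) K ⧸ J) = d := by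
    generalize ringKrullDim (MvPolynomial (V ⊕ V) K ⧸ J) = r at h0 htop
    cases r with
    | bot => simp at h0
    | coe r =>
      cases r with
      | top => exact absurd (WithBot.coe_le_coe.mp htop) (by simp)
      | coe r => exact ⟨r, rfl⟩
  obtain ⟨l, hl⟩ : ∃ l : LTSeries (PrimeSpectrum.zeroLocus (R := MvPolynomial (V ⊕ V) K) J),
      l.length = d := by
    rw [← Order.le_krullDim_iff, ← ringKrullDim_quotient, hd]
  set P := l.head.1.asIdeal
  have hJP : J ≤ P := l.head.2
  obtain ⟨f, hf, hle⟩ := exists_coloring_trdeg_le K G P hJP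
  refine ⟨_, f, hf, le_antisymm ?_ (coloringDim_le_ringKrullDim K hf)⟩
  obtain ⟨t, ht⟩ := Cardinal.lt_aleph0.mp (hle.trans_lt (Cardinal.natCast_lt_aleph0))
  rw [ht] at hle
  calc ringKrullDim (MvPolynomial (V ⊕ V) K ⧸ J) = (l.length : ℕ) := by rw [hl, hd]
    _ ≤ ringKrullDim (MvPolynomial (V ⊕ V) K ⧸ P) := by
        rw [ringKrullDim_quotient]
        exact Order.le_krullDim_iff.mpr ⟨⟨l.length, fun i ↦ ⟨(l i).1, l.head_le i⟩, l.step⟩, rfl⟩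
    _ = (t : ℕ) := ringKrullDim_eq_of_trdeg_eq ht
    _ ≤ (coloringDim f : ℕ) := by exact_mod_cast hle

/-- Neighbours of a free vertex are pairwise adjacent. -/
lemma adj_of_cliqueDegOn_eq_one {V : Type*} [Finite V] {G : SimpleGraph V} {W : Set V} {v : V}
    (hv : v ∈ W) (h : cliqueDegOn G W v = 1) {a b : V} (ha : a ∈ W) (hb : b ∈ W)
    (hva : G.Adj v a) (hvb : G.Adj v b) (hab : a ≠ b) : G.Adj a b := by
  obtain ⟨B, hB⟩ := Set.ncard_eq_one.mp h
  have key : ∀ c ∈ W, G.Adj v c → c ∈ B := fun c hc hvc ↦ by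
    obtain ⟨D, hD, hmax⟩ := Set.Finite.exists_le_maximal
      (s := {s : Set V | s ⊆ W ∧ G.IsClique s}) (Set.toFinite _) (a := {v, c})
      ⟨Set.insert_subset hv (Set.singleton_subset_iff.mpr hc),
        SimpleGraph.isClique_pair.mpr fun _ ↦ hvc⟩
    have hDB : D ∈ ({B} : Set (Set V)) := hB ▸ ⟨hmax, hD (Set.mem_insert _ _)⟩
    rw [Set.mem_singleton_iff] at hDB
    exact hDB ▸ hD (Set.mem_insert_of_mem _ rfl)
  have hBm : B ∈ {B : Set V | IsMaxCliqueOn G W B ∧ v ∈ B} := hB ▸ Set.mem_singleton B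
  exact hBm.1.prop.2 (key a ha hva) (key b hb hvb) hab

/-- Colouring an uncoloured free vertex increases `coloringDim`. -/
lemma exists_coloring_of_eq_none {V : Type*} {C : Type*} [Finite V] {H : SimpleGraph V}
    {f : V → Option C} (hf : IsPartialComponentColoring H f) {v : V}
    (hN : ∀ a b, H.Adj v a → H.Adj v b → a ≠ b → H.Adj a b) (hv : f v = none) :
    ∃ g : V → Option (Option C), IsPartialComponentColoring H g ∧
      coloringDim f + 1 ≤ coloringDim g := by
  classical
  obtain ⟨e, he⟩ : ∃ e : Option C, ∀ w, H.Adj v w → ∀ c, f w = some c → e = some c := by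
    by_cases hw : ∃ w, H.Adj v w ∧ f w ≠ none
    · obtain ⟨w, hvw, hw⟩ := hw
      refine ⟨f w, fun u hvu c hu ↦ ?_⟩
      obtain ⟨d, hd⟩ := Option.ne_none_iff_exists'.mp hw
      by_cases huw : u = w
      · rw [← huw, hu]
      · rw [hd, hf u w (hN u w hvu hvw huw) c d hu hd]
    · push Not at hw
      exact ⟨none, fun w hvw c hc ↦ by simp [hw w hvw] at hc⟩
  let g : V → Option (Option C) := fun i ↦ if i = v then some e else (f i).map some
  have hgv : g v = some e := if_pos rfl
  have hg : ∀ i, i ≠ v → g i = (f i).map some := fun i hi ↦ if_neg hi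
  refine ⟨g, ?_, ?_⟩
  · intro i j hij c d hc hd
    by_cases hi : i = v
    · subst hi
      rw [hg j hij.ne', Option.map_eq_some_iff] at hd
      obtain ⟨d', hd', rfl⟩ := hd
      rw [hgv, Option.some_inj] at hc
      rw [← hc, he j hij d' hd']
    · rw [hg i hi, Option.map_eq_some_iff] at hc
      obtain ⟨c', hc', rfl⟩ := hc
      by_cases hj : j = v
      · subst hj
        rw [hgv, Option.some_inj] at hd
        rw [← hd, he i hij.symm c' hc']
      · rw [hg j hj, Option.map_eq_some_iff] at hd
        obtain ⟨d', hd', rfl⟩ := hd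
        rw [hf i j hij c' d' hc' hd']
  · have h1 : insert v {i | f i ≠ none} ⊆ {i | g i ≠ none} := by
      rintro i (rfl | hi)
      · simp [hgv]
      · have : i ≠ v := by rintro rfl; exact hi hv
        simpa [hg i this] using hi
    have h2 : some '' {c | ∃ i, f i = some c} ⊆ {c | ∃ i, g i = some c} := by
      rintro _ ⟨c, ⟨i, hi⟩, rfl⟩
      have : i ≠ v := by rintro rfl; simp [hv] at hi
      exact ⟨i, by simp [hg i this, hi]⟩
    have h3 := Set.ncard_le_ncard h1 (Set.toFinite _)
    have h4 := Set.ncard_le_ncard h2 (finite_colors g)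
    rw [Set.ncard_insert_of_notMem (by simp [hv]) (Set.toFinite _)] at h3
    rw [Set.ncard_image_of_injective _ (Option.some_injective C)] at h4
    simp only [coloringDim]
    omega

/-- Restricting a colouring to two sets of vertices meeting in a single vertex `v`. -/
lemma ncard_colored_restrict {V C : Type*} [Finite V] {W₁ W₂ : Set V} {v : V}
    (hunion : W₁ ∪ W₂ = Set.univ) (hinter : W₁ ∩ W₂ = {v}) (f : V → Option C) :
    {i | f i ≠ none}.ncard + ({v} ∩ {i | f i ≠ none}).ncard =
      {i : W₁ | f i ≠ none}.ncard + {i : W₂ | f i ≠ none}.ncard := by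
  have key : ∀ W : Set V, {i : W | f i ≠ none}.ncard = (W ∩ {i | f i ≠ none}).ncard := fun W ↦ by
    rw [← Set.ncard_image_of_injective _ Subtype.val_injective]
    congr 1
    ext i
    simp [and_comm]
  rw [key, key, ← Set.ncard_union_add_ncard_inter (W₁ ∩ _) _ (Set.toFinite _) (Set.toFinite _),
    ← Set.union_inter_distrib_right, hunion, Set.univ_inter, ← Set.inter_inter_distrib_right,
    hinter]

lemma coloringDim_add_two_le_restrict_add_restrict {V C : Type*} [Finite V] {W₁ W₂ : Set V} {v : V}
    (hunion : W₁ ∪ W₂ = Set.univ) (hinter : W₁ ∩ W₂ = {v}) (f : V → Option C) {c : C}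
    (hc : f v = some c) :
    coloringDim f + 2 ≤ coloringDim (fun i : W₁ ↦ f i) + coloringDim (fun i : W₂ ↦ f i) := by
  have h := ncard_colored_restrict hunion hinter f
  have hv : v ∈ W₁ ∩ W₂ := hinter ▸ Set.mem_singleton v
  rw [Set.inter_eq_left.mpr (Set.singleton_subset_iff.mpr (by simp [hc])),
    Set.ncard_singleton] at h
  have hU : {c | ∃ i, f i = some c} ⊆
      {c | ∃ i : W₁, f i = some c} ∪ {c | ∃ i : W₂, f i = some c} := by
    rintro d ⟨i, hi⟩
    rcases (hunion ▸ Set.mem_univ i : i ∈ W₁ ∪ W₂) with h | h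
    exacts [Or.inl ⟨⟨i, h⟩, hi⟩, Or.inr ⟨⟨i, h⟩, hi⟩]
  have hI : {c} ⊆ {c | ∃ i : W₁, f i = some c} ∩ {c | ∃ i : W₂, f i = some c} :=
    Set.singleton_subset_iff.mpr ⟨⟨⟨v, hv.1⟩, hc⟩, ⟨⟨v, hv.2⟩, hc⟩⟩
  have h₁ := finite_colors (fun i : W₁ ↦ f i)
  have h₂ := finite_colors (fun i : W₂ ↦ f i)
  have h3 := Set.ncard_le_ncard hU (h₁.union h₂)
  have h4 := Set.ncard_le_ncard hI (h₁.inter_of_left _)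
  have h5 := Set.ncard_union_add_ncard_inter _ _ h₁ h₂
  rw [Set.ncard_singleton] at h4
  simp only [coloringDim]
  omega

lemma coloringDim_le_restrict_add_restrict {V C : Type*} [Finite V] {W₁ W₂ : Set V} {v : V}
    (hunion : W₁ ∪ W₂ = Set.univ) (hinter : W₁ ∩ W₂ = {v}) (f : V → Option C) :
    coloringDim f ≤ coloringDim (fun i : W₁ ↦ f i) + coloringDim (fun i : W₂ ↦ f i) := by
  have h := ncard_colored_restrict hunion hinter f
  have hU : {c | ∃ i, f i = some c} ⊆
      {c | ∃ i : W₁, f i = some c} ∪ {c | ∃ i : W₂, f i = some c} := by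
    rintro d ⟨i, hi⟩
    rcases (hunion ▸ Set.mem_univ i : i ∈ W₁ ∪ W₂) with h | h
    exacts [Or.inl ⟨⟨i, h⟩, hi⟩, Or.inr ⟨⟨i, h⟩, hi⟩]
  have h3 := (Set.ncard_le_ncard hU ((finite_colors (fun i : W₁ ↦ f i)).union
    (finite_colors (fun i : W₂ ↦ f i)))).trans (Set.ncard_union_le _ _)
  simp only [coloringDim]
  omega

/-- Gluing two colourings along a common coloured vertex. -/
lemma exists_glued_coloring {V C₁ C₂ : Type*} [Finite V] {G : SimpleGraph V} {W₁ W₂ : Set V}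
    {v : V} (hunion : W₁ ∪ W₂ = Set.univ) (hinter : W₁ ∩ W₂ = {v})
    (hedges : ∀ a b, G.Adj a b → (a ∈ W₁ ∧ b ∈ W₁) ∨ (a ∈ W₂ ∧ b ∈ W₂))
    (hv₁ : v ∈ W₁) (hv₂ : v ∈ W₂)
    {f₁ : W₁ → Option C₁} (hf₁ : IsPartialComponentColoring (G.induce W₁) f₁)
    {f₂ : W₂ → Option C₂} (hf₂ : IsPartialComponentColoring (G.induce W₂) f₂)
    {c₁ : C₁} (hc₁ : f₁ ⟨v, hv₁⟩ = some c₁) {c₂ : C₂} (hc₂ : f₂ ⟨v, hv₂⟩ = some c₂) :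
    ∃ f : V → Option (C₁ × C₂), IsPartialComponentColoring G f ∧
      coloringDim f + 2 = coloringDim f₁ + coloringDim f₂ := by
  classical
  have hW₂ : ∀ i, i ∉ W₁ → i ∈ W₂ := fun i hi ↦
    (hunion ▸ Set.mem_univ i : i ∈ W₁ ∪ W₂).resolve_left hi
  let f : V → Option (C₁ × C₂) := fun i ↦
    if h : i ∈ W₁ then (f₁ ⟨i, h⟩).map (·, c₂) else (f₂ ⟨i, hW₂ i h⟩).map (c₁, ·)
  have h₁ : ∀ i : W₁, f i = (f₁ i).map (·, c₂) := fun i ↦ dif_pos i.2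
  have h₂ : ∀ i : W₂, f i = (f₂ i).map (c₁, ·) := by
    rintro ⟨i, hi⟩
    by_cases h : i ∈ W₁
    · obtain rfl : i = v := by
        have : i ∈ ({v} : Set V) := hinter ▸ ⟨h, hi⟩
        exact this
      rw [hc₂]
      simp [f, hc₁, h]
    · exact dif_neg h
  refine ⟨f, ?_, ?_⟩
  · intro i j hij c d hc hd
    rcases hedges i j hij with ⟨hi, hj⟩ | ⟨hi, hj⟩
    · rw [h₁ ⟨i, hi⟩, Option.map_eq_some_iff] at hc
      rw [h₁ ⟨j, hj⟩, Option.map_eq_some_iff] at hd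
      obtain ⟨c', hc', rfl⟩ := hc
      obtain ⟨d', hd', rfl⟩ := hd
      rw [hf₁ ⟨i, hi⟩ ⟨j, hj⟩ hij c' d' hc' hd']
    · rw [h₂ ⟨i, hi⟩, Option.map_eq_some_iff] at hc
      rw [h₂ ⟨j, hj⟩, Option.map_eq_some_iff] at hd
      obtain ⟨c', hc', rfl⟩ := hc
      obtain ⟨d', hd', rfl⟩ := hd
      rw [hf₂ ⟨i, hi⟩ ⟨j, hj⟩ hij c' d' hc' hd']
  · have hfv : f v ≠ none := by rw [h₁ ⟨v, hv₁⟩, hc₁]; simp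
    have h := ncard_colored_restrict hunion hinter f
    rw [Set.inter_eq_left.mpr (Set.singleton_subset_iff.mpr hfv), Set.ncard_singleton] at h
    simp only [h₁, h₂, ne_eq, Option.map_eq_none_iff] at h
    have hU : {c | ∃ i, f i = some c} = (·, c₂) '' {c | ∃ i, f₁ i = some c} ∪
        (c₁, ·) '' {c | ∃ i, f₂ i = some c} := by
      ext c
      constructor
      · rintro ⟨i, hi⟩
        rcases (hunion ▸ Set.mem_univ i : i ∈ W₁ ∪ W₂) with h | h
        · rw [h₁ ⟨i, h⟩, Option.map_eq_some_iff] at hi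
          obtain ⟨c', hc', rfl⟩ := hi
          exact Or.inl ⟨c', ⟨_, hc'⟩, rfl⟩
        · rw [h₂ ⟨i, h⟩, Option.map_eq_some_iff] at hi
          obtain ⟨c', hc', rfl⟩ := hi
          exact Or.inr ⟨c', ⟨_, hc'⟩, rfl⟩
      · rintro (⟨c', ⟨i, hi⟩, rfl⟩ | ⟨c', ⟨i, hi⟩, rfl⟩)
        · exact ⟨i, by simp [h₁, hi]⟩
        · exact ⟨i, by simp [h₂, hi]⟩
    have hI : (·, c₂) '' {c | ∃ i, f₁ i = some c} ∩ (c₁, ·) '' {c | ∃ i, f₂ i = some c} =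
        {(c₁, c₂)} := by
      ext c
      constructor
      · rintro ⟨⟨a, -, rfl⟩, ⟨b, -, hb⟩⟩
        simp_all
      · rintro rfl
        exact ⟨⟨c₁, ⟨_, hc₁⟩, rfl⟩, ⟨c₂, ⟨_, hc₂⟩, rfl⟩⟩
    have h5 := Set.ncard_union_add_ncard_inter _ _
      ((finite_colors f₁).image (·, c₂)) ((finite_colors f₂).image (c₁, ·))
    rw [← hU, hI, Set.ncard_singleton,
      Set.ncard_image_of_injective _ (Prod.mk_left_injective c₂),
      Set.ncard_image_of_injective _ (Prod.mk_right_injective c₁)] at h5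
    simp only [coloringDim, ne_eq]
    omega

/-- For a free vertex `v`, the dimension of `S/J_H` is computed by a colouring in which `v` is
coloured. -/
lemma exists_coloring_ringKrullDim_eq_of_free.{u} (K : Type u) [Field K] {V : Type} [Finite V]
    (H : SimpleGraph V) {v : V} (hN : ∀ a b, H.Adj v a → H.Adj v b → a ≠ b → H.Adj a b) :
    ∃ (C : Type u) (f : V → Option C) (c : C), IsPartialComponentColoring H f ∧
      ringKrullDim (MvPolynomial (V ⊕ V) K ⧸ binomialEdgeIdeal K H) = coloringDim f ∧
      f v = some c := by
  obtain ⟨C, f, hf, hd⟩ := exists_coloring_ringKrullDim_eq K H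
  rcases hv : f v with _ | c
  · obtain ⟨g, hg, hle⟩ := exists_coloring_of_eq_none hf hN hv
    have := coloringDim_le_ringKrullDim K hg
    rw [hd] at this
    have : coloringDim g ≤ coloringDim f := by exact_mod_cast this
    omega
  · exact ⟨C, f, c, hf, hd, hv⟩

/-- if `G` is decomposable into `G₁` and `G₂` (recorded by their
vertex sets `W₁, W₂`, meeting in the single vertex `v`, free in both, each with
an edge), then `dim S/J_G = dim S₁/J_{G₁} + dim S₂/J_{G₂} - 2`. -/
theorem ringKrullDim_of_decomposition (n : ℕ) (K : Type*) [Field K]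
    (G : SimpleGraph (Fin n)) (W₁ W₂ : Set (Fin n)) (v : Fin n)
    (hunion : W₁ ∪ W₂ = Set.univ) (hinter : W₁ ∩ W₂ = {v})
    (hedges : ∀ a b, G.Adj a b → (a ∈ W₁ ∧ b ∈ W₁) ∨ (a ∈ W₂ ∧ b ∈ W₂))
    (he₁ : ∃ a ∈ W₁, ∃ b ∈ W₁, G.Adj a b) (he₂ : ∃ a ∈ W₂, ∃ b ∈ W₂, G.Adj a b)
    (hfree₁ : cliqueDegOn G W₁ v = 1) (hfree₂ : cliqueDegOn G W₂ v = 1) :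
    ringKrullDim (MvPolynomial (↥W₁ ⊕ ↥W₁) K ⧸ binomialEdgeIdeal K (G.induce W₁))
      + ringKrullDim (MvPolynomial (↥W₂ ⊕ ↥W₂) K ⧸ binomialEdgeIdeal K (G.induce W₂))
      = ringKrullDim (MvPolynomial (Fin n ⊕ Fin n) K ⧸ binomialEdgeIdeal K G) + 2 := by
  have hv : v ∈ W₁ ∩ W₂ := hinter ▸ Set.mem_singleton v
  have hN₁ : ∀ a b, (G.induce W₁).Adj ⟨v, hv.1⟩ a → (G.induce W₁).Adj ⟨v, hv.1⟩ b → a ≠ b →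
      (G.induce W₁).Adj a b := fun a b ha hb hab ↦
    adj_of_cliqueDegOn_eq_one hv.1 hfree₁ a.2 b.2 ha hb (Subtype.coe_ne_coe.mpr hab)
  have hN₂ : ∀ a b, (G.induce W₂).Adj ⟨v, hv.2⟩ a → (G.induce W₂).Adj ⟨v, hv.2⟩ b → a ≠ b →
      (G.induce W₂).Adj a b := fun a b ha hb hab ↦
    adj_of_cliqueDegOn_eq_one hv.2 hfree₂ a.2 b.2 ha hb (Subtype.coe_ne_coe.mpr hab)
  obtain ⟨C₁, f₁, c₁, hf₁, hd₁, hc₁⟩ := exists_coloring_ringKrullDim_eq_of_free K _ hN₁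
  obtain ⟨C₂, f₂, c₂, hf₂, hd₂, hc₂⟩ := exists_coloring_ringKrullDim_eq_of_free K _ hN₂
  obtain ⟨C, f, hf, hd⟩ := exists_coloring_ringKrullDim_eq K G
  have hle₁ : ∀ {D : Type _} {g : W₁ → Option D}, IsPartialComponentColoring (G.induce W₁) g →
      coloringDim g ≤ coloringDim f₁ := fun hg ↦ by
    have := coloringDim_le_ringKrullDim K hg
    rw [hd₁] at this
    exact_mod_cast this
  have hle₂ : ∀ {D : Type _} {g : W₂ → Option D}, IsPartialComponentColoring (G.induce W₂) g →
      coloringDim g ≤ coloringDim f₂ := fun hg ↦ by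
    have := coloringDim_le_ringKrullDim K hg
    rw [hd₂] at this
    exact_mod_cast this
  have hr₁ : IsPartialComponentColoring (G.induce W₁) (fun i : W₁ ↦ f i) :=
    fun i j hij ↦ hf i j hij
  have hr₂ : IsPartialComponentColoring (G.induce W₂) (fun i : W₂ ↦ f i) :=
    fun i j hij ↦ hf i j hij
  have hupper : coloringDim f + 2 ≤ coloringDim f₁ + coloringDim f₂ := by
    rcases hfv : f v with _ | c
    · obtain ⟨g₁, hg₁, h₁⟩ := exists_coloring_of_eq_none hr₁ hN₁ hfv
      obtain ⟨g₂, hg₂, h₂⟩ := exists_coloring_of_eq_none hr₂ hN₂ hfv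
      have h₃ := hle₁ hg₁
      have h₄ := hle₂ hg₂
      have h₅ := coloringDim_le_restrict_add_restrict hunion hinter f
      omega
    · have h₁ := hle₁ hr₁
      have h₂ := hle₂ hr₂
      have h₃ := coloringDim_add_two_le_restrict_add_restrict hunion hinter f hfv
      omega
  obtain ⟨g, hg, hgd⟩ := exists_glued_coloring hunion hinter hedges hv.1 hv.2 hf₁ hf₂ hc₁ hc₂
  have hlower := coloringDim_le_ringKrullDim K hg
  rw [hd] at hlower
  have hlower : coloringDim g ≤ coloringDim f := by exact_mod_cast hlower
  rw [hd₁, hd₂, hd]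
  have : coloringDim f₁ + coloringDim f₂ = coloringDim f + 2 := by omega
  exact_mod_cast this
end
end

section
/- Let G be a block graph on [n], T ∈ C(G) a cutset of G, and v ∈ T. Then T ∖ {v} is also a cutset of G. -/
/-!
Common definitions: binomial edge ideals, cutsets, the prime ideals `P_T(G)`,
block graphs, clique degrees, endblocks, decomposability, and their relative
versions for induced subgraphs (an induced subgraph of `G` is recorded by its
vertex set `W`).
-/

noncomputable section
open MvPolynomial

/-- In a block graph, two neighbours of `i` that are joined by a walk avoiding `i`
are equal or adjacent. -/
theorem IsBlockGraph.eq_or_adj_of_reachable {V : Type*} {G : SimpleGraph V}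
    (hG : IsBlockGraph G) {W : Set V} {i : V} (hi : i ∉ W) {a b : W}
    (ha : G.Adj i a) (hb : G.Adj i b) (h : (G.induce W).Reachable a b) :
    a = b ∨ G.Adj a b := by
  by_contra! hne
  obtain ⟨hab, hadj⟩ := hne
  have hab' : (a : V) ≠ b := fun h => hab (Subtype.ext h)
  obtain ⟨p, hp⟩ := h.exists_isPath
  let φ := SimpleGraph.Embedding.induce (G := G) W
  let q : G.Walk (a : V) (b : V) := p.map φ.toHom
  have hq : q.IsPath := hp.map φ.injective
  have hiq : i ∉ q.support := by
    intro hmem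
    obtain ⟨x, -, rfl⟩ := List.mem_map.1 ((p.support_map φ.toHom) ▸ hmem)
    exact hi x.2
  have hcycle : (SimpleGraph.Walk.cons ha (q.concat hb.symm)).IsCycle := by
    rw [SimpleGraph.Walk.cons_isCycle_iff]
    refine ⟨hq.concat hiq hb.symm, ?_⟩
    rw [SimpleGraph.Walk.edges_concat, List.concat_eq_append, List.mem_append,
      List.mem_singleton]
    rintro (h | h)
    · exact hiq (q.fst_mem_support_of_mem_edges h)
    · rcases Sym2.eq_iff.1 h with ⟨-, h⟩ | ⟨-, h⟩
      · exact ha.ne h.symm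
      · exact hab' h
  refine hadj (hG i _ hcycle a ?_ b ?_ hab') <;>
    simp [SimpleGraph.Walk.support_concat]

/-- If the neighbours of `i` outside `T` are connected to each other in `G - T`, then
putting `i` back creates no new connections. -/
theorem reachable_induce_compl_of_reachable_induce_compl_sdiff {V : Type*}
    {G : SimpleGraph V} {T : Set V} {i : V}
    (h : ∀ a b : (Tᶜ : Set V), G.Adj i a → G.Adj i b → (G.induce Tᶜ).Reachable a b)
    {x y : ((T \ {i})ᶜ : Set V)} (hxy : (G.induce (T \ {i})ᶜ).Reachable x y)
    (hx : (x : V) ∈ Tᶜ) (hy : (y : V) ∈ Tᶜ) :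
    (G.induce Tᶜ).Reachable ⟨x, hx⟩ ⟨y, hy⟩ := by
  obtain ⟨p⟩ := hxy
  suffices H : ∃ z : (Tᶜ : Set V), ((z : V) = x ∨ (x : V) ∈ T ∧ G.Adj i z) ∧
      (G.induce Tᶜ).Reachable z ⟨y, hy⟩ by
    obtain ⟨z, hz | hz, hzy⟩ := H
    · rwa [show (⟨x, hx⟩ : (Tᶜ : Set V)) = z from Subtype.ext hz.symm]
    · exact absurd hz.1 hx
  clear hx
  induction p with
  | nil => exact ⟨⟨_, hy⟩, Or.inl rfl, SimpleGraph.Reachable.refl _⟩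
  | @cons u w _ huw p ih =>
    obtain ⟨z, hz, hzy⟩ := ih hy
    have huw : G.Adj u w := huw
    have eq_of_mem : ∀ s : ((T \ {i})ᶜ : Set V), (s : V) ∈ T → (s : V) = i :=
      fun s hs => by_contra fun hne => s.2 ⟨hs, hne⟩
    by_cases hu : (u : V) ∈ T
    · have hui := eq_of_mem u hu
      rcases hz with hz | hz
      · exact ⟨z, Or.inr ⟨hu, hz ▸ (congrArg (G.Adj · (w : V)) hui).mp huw⟩, hzy⟩
      · exact absurd (hui.trans (eq_of_mem w hz.1).symm) huw.ne
    · refine ⟨⟨u, hu⟩, Or.inl rfl, SimpleGraph.Reachable.trans ?_ hzy⟩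
      rcases hz with hz | hz
      · refine SimpleGraph.Adj.reachable ?_
        change G.Adj u z
        rwa [hz]
      · exact h _ _ (by simpa [← eq_of_mem w hz.1] using huw.symm) hz.2

/-- The vertex `i` reconnects components of `G - T` iff it has two neighbours
lying in different components of `G - T`. -/
theorem numComp_sdiff_singleton_lt_iff {V : Type*} [Finite V] {G : SimpleGraph V}
    {T : Set V} {i : V} :
    numComp G (T \ {i}) < numComp G T ↔
      ∃ a b : (Tᶜ : Set V), G.Adj i a ∧ G.Adj i b ∧ ¬ (G.induce Tᶜ).Reachable a b := by
  have hsub : Tᶜ ⊆ (T \ {i})ᶜ := Set.compl_subset_compl.2 Set.sdiff_subset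
  let φ := (SimpleGraph.induceHomOfLE G hsub).toHom
  let f : (G.induce Tᶜ).ConnectedComponent → (G.induce (T \ {i})ᶜ).ConnectedComponent :=
    SimpleGraph.ConnectedComponent.map φ
  constructor
  · intro hlt
    by_contra! h
    refine hlt.not_ge (Nat.card_le_card_of_injective f ?_)
    intro c d
    refine SimpleGraph.ConnectedComponent.ind₂ (fun x y hxy => ?_) c d
    exact SimpleGraph.ConnectedComponent.sound
      (reachable_induce_compl_of_reachable_induce_compl_sdiff h
        (SimpleGraph.ConnectedComponent.exact hxy) x.2 y.2)
  · rintro ⟨a, b, ha, hb, hab⟩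
    let i' : ((T \ {i})ᶜ : Set V) := ⟨i, fun h => h.2 rfl⟩
    have hia : (G.induce (T \ {i})ᶜ).Adj i' (φ a) := ha
    have hib : (G.induce (T \ {i})ᶜ).Adj i' (φ b) := hb
    have hsurj : Function.Surjective f := by
      refine SimpleGraph.ConnectedComponent.ind fun x => ?_
      by_cases hx : (x : V) ∈ T
      · have hxi : x = i' := Subtype.ext (by_contra fun hne => x.2 ⟨hx, hne⟩)
        exact ⟨SimpleGraph.connectedComponentMk _ a,
          SimpleGraph.ConnectedComponent.sound (hxi ▸ hia.symm.reachable)⟩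
      · exact ⟨SimpleGraph.connectedComponentMk _ ⟨x, hx⟩, rfl⟩
    refine (Nat.card_le_card_of_surjective f hsurj).lt_of_ne fun heq => hab ?_
    have hinj : Function.Injective f :=
      ((Nat.bijective_iff_surjective_and_card f).2 ⟨hsurj, heq.symm⟩).1
    exact SimpleGraph.ConnectedComponent.exact (hinj
      (SimpleGraph.ConnectedComponent.sound (hia.symm.reachable.trans hib.reachable)))

/-- in a block graph, removing any vertex from a cutset yields a
cutset. -/
theorem cutset_sdiff_singleton (n : ℕ) (G : SimpleGraph (Fin n))
    (hblock : IsBlockGraph G) (T : Set (Fin n)) (hT : IsCutset G T)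
    (v : Fin n) (hv : v ∈ T) :
    IsCutset G (T \ {v}) := by
  rintro i ⟨hiT, hiv⟩
  obtain ⟨a, b, ha, hb, hab⟩ := numComp_sdiff_singleton_lt_iff.1 (hT i hiT)
  have hsub : Tᶜ ⊆ (T \ {v})ᶜ := Set.compl_subset_compl.2 Set.sdiff_subset
  refine numComp_sdiff_singleton_lt_iff.2
    ⟨⟨a, hsub a.2⟩, ⟨b, hsub b.2⟩, ha, hb, fun hreach => hab ?_⟩
  have hi : i ∉ (T \ {v})ᶜ := Set.notMem_compl_iff.2 ⟨hiT, hiv⟩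
  rcases hblock.eq_or_adj_of_reachable hi ha hb hreach with h | h
  · obtain rfl : a = b := Subtype.ext (Subtype.mk.inj h)
    exact SimpleGraph.Reachable.refl a
  · exact SimpleGraph.Adj.reachable (G := G.induce Tᶜ) h
end
end
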